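/- arXiv:2507.07814 — 5 statements merged into one kernel-verified Lean document; each statement's English description precedes it below -/
import Mathlib

section
/- Let x ∈ ℝⁿ be a vector with x_1 ≥ x_2 ≥ … ≥ x_n ≥ 0 and Σᵢ xᵢ = 1, and let A = diag(x) − x xᵀ. Then A is symmetric positive semidefinite, so its singular values σ_1 ≥ … ≥ σ_n coincide with its eigenvalues, and they satisfy the interlacing chain x_1 ≥ g_1(x) ≥ σ_1 ≥ x_2 ≥ g_2(x) ≥ σ_2 ≥ … ≥ x_n ≥ g_n(x) ≥ σ_n = 0, where g_k(x) = x_k(1 − x_k + x_{k+1}) for 1 ≤ k ≤ n−1 and g_n(x) = x_n(1 − x_n). -/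
open Matrix

/-- Fewer linear functionals than the dimension have a common nonzero zero. -/
theorem exists_ne_zero_forall_eq_zero {n : ℕ} {ι : Type*} [Fintype ι]
    (φ : ι → (Fin n → ℝ) →ₗ[ℝ] ℝ) (hι : Fintype.card ι < n) :
    ∃ v : Fin n → ℝ, v ≠ 0 ∧ ∀ i, φ i v = 0 := by
  have hker : LinearMap.ker (LinearMap.pi φ) ≠ ⊥ :=
    LinearMap.ker_ne_bot_of_finrank_lt (by simpa using hι)
  obtain ⟨v, hv, hv0⟩ := Submodule.exists_mem_ne_zero_of_ne_bot hker
  exact ⟨v, hv0, fun i => congrFun (LinearMap.mem_ker.mp hv) i⟩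

/-- A common nonzero zero for two families of linear functionals. -/
theorem exists_ne_zero_forall_eq_zero_and {n : ℕ} {ι κ : Type*} [Fintype ι] [Fintype κ]
    (φ : ι → (Fin n → ℝ) →ₗ[ℝ] ℝ) (ψ : κ → (Fin n → ℝ) →ₗ[ℝ] ℝ)
    (h : Fintype.card ι + Fintype.card κ < n) :
    ∃ v : Fin n → ℝ, v ≠ 0 ∧ (∀ i, φ i v = 0) ∧ ∀ i, ψ i v = 0 := by
  obtain ⟨v, hv0, hv⟩ := exists_ne_zero_forall_eq_zero (Sum.elim φ ψ) (by simpa using h)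
  exact ⟨v, hv0, fun i => hv (Sum.inl i), fun i => hv (Sum.inr i)⟩

section Hermitian

variable {n : ℕ} {A : Matrix (Fin n) (Fin n) ℝ}

/-- The `j`-th coordinate functional with respect to the eigenvector basis. -/
noncomputable def eigenCoord (hA : A.IsHermitian) (j : Fin n) : (Fin n → ℝ) →ₗ[ℝ] ℝ :=
  dotProductBilin ℝ ℝ (WithLp.ofLp (hA.eigenvectorBasis j))

theorem sum_eigenCoord_mul_eigenCoord (hA : A.IsHermitian) (v w : Fin n → ℝ) :
    ∑ j, eigenCoord hA j v * eigenCoord hA j w = v ⬝ᵥ w := by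
  have h := hA.eigenvectorBasis.sum_inner_mul_inner (WithLp.toLp 2 v) (WithLp.toLp 2 w)
  simp only [EuclideanSpace.inner_eq_star_dotProduct, star_trivial] at h
  rw [dotProduct_comm v w, ← h]
  refine Finset.sum_congr rfl fun j _ => ?_
  simp [eigenCoord, dotProduct_comm]

theorem eigenCoord_mulVec (hA : A.IsHermitian) (j : Fin n) (v : Fin n → ℝ) :
    eigenCoord hA j (A *ᵥ v) = hA.eigenvalues j * eigenCoord hA j v := by
  have hT : Aᵀ = A := (conjTranspose_eq_transpose_of_trivial A).symm.trans hA
  simp only [eigenCoord, dotProductBilin_apply_apply]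
  rw [dotProduct_mulVec, ← mulVec_transpose, hT, hA.mulVec_eigenvectorBasis, smul_dotProduct,
    smul_eq_mul]

theorem dotProduct_mulVec_eq_sum_eigenvalues (hA : A.IsHermitian) (v : Fin n → ℝ) :
    v ⬝ᵥ A *ᵥ v = ∑ j, hA.eigenvalues j * eigenCoord hA j v ^ 2 := by
  rw [← sum_eigenCoord_mul_eigenCoord hA]
  refine Finset.sum_congr rfl fun j _ => ?_
  rw [eigenCoord_mulVec]
  ring

variable {σ : Fin n → ℝ} {e : Equiv.Perm (Fin n)} {ι : Type*} [Fintype ι]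

/-- Upper half of the Courant–Fischer principle: an upper bound for the quadratic form on a
subspace of codimension at most `k` bounds the `k`-th largest eigenvalue (counted from `0`). -/
theorem sorted_eigenvalue_le (hA : A.IsHermitian) (hσ : ∀ i, σ i = hA.eigenvalues (e i))
    (hanti : Antitone σ) (k : Fin n) (φ : ι → (Fin n → ℝ) →ₗ[ℝ] ℝ) (hι : Fintype.card ι ≤ k)
    {c : ℝ} (h : ∀ v, (∀ i, φ i v = 0) → v ⬝ᵥ A *ᵥ v ≤ c * (v ⬝ᵥ v)) : σ k ≤ c := by
  obtain ⟨v, hv0, hφ, hv⟩ := exists_ne_zero_forall_eq_zero_and φ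
    (fun j : Finset.Ioi k => eigenCoord hA (e j)) (by rw [Fintype.card_coe, Fin.card_Ioi]; omega)
  have hpos : 0 < v ⬝ᵥ v := by simpa using dotProduct_star_self_pos_iff.mpr hv0
  refine le_of_mul_le_mul_right (le_trans ?_ (h v hφ)) hpos
  rw [dotProduct_mulVec_eq_sum_eigenvalues hA, ← sum_eigenCoord_mul_eigenCoord hA v v,
    ← Equiv.sum_comp e, ← Equiv.sum_comp e (fun j => hA.eigenvalues j * _), Finset.mul_sum]
  refine Finset.sum_le_sum fun j _ => ?_
  rw [← hσ, ← sq]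
  rcases le_or_gt j k with hj | hj
  · exact mul_le_mul_of_nonneg_right (hanti hj) (sq_nonneg _)
  · simp [hv ⟨j, Finset.mem_Ioi.mpr hj⟩]

/-- Lower half of the Courant–Fischer principle: a lower bound for the quadratic form on a
subspace of dimension more than `k` bounds the `k`-th largest eigenvalue (counted from `0`). -/
theorem le_sorted_eigenvalue (hA : A.IsHermitian) (hσ : ∀ i, σ i = hA.eigenvalues (e i))
    (hanti : Antitone σ) (k : Fin n) (φ : ι → (Fin n → ℝ) →ₗ[ℝ] ℝ)
    (hι : Fintype.card ι + k < n)
    {c : ℝ} (h : ∀ v, (∀ i, φ i v = 0) → c * (v ⬝ᵥ v) ≤ v ⬝ᵥ A *ᵥ v) : c ≤ σ k := by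
  obtain ⟨v, hv0, hφ, hv⟩ := exists_ne_zero_forall_eq_zero_and φ
    (fun j : Finset.Iio k => eigenCoord hA (e j)) (by rwa [Fintype.card_coe, Fin.card_Iio])
  have hpos : 0 < v ⬝ᵥ v := by simpa using dotProduct_star_self_pos_iff.mpr hv0
  refine le_of_mul_le_mul_right (le_trans (h v hφ) ?_) hpos
  rw [dotProduct_mulVec_eq_sum_eigenvalues hA, ← sum_eigenCoord_mul_eigenCoord hA v v,
    ← Equiv.sum_comp e, ← Equiv.sum_comp e (fun j => eigenCoord hA j v * _), Finset.mul_sum]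
  refine Finset.sum_le_sum fun j _ => ?_
  rw [← hσ, ← sq]
  rcases le_or_gt k j with hj | hj
  · exact mul_le_mul_of_nonneg_right (hanti hj) (sq_nonneg _)
  · simp [hv ⟨j, Finset.mem_Iio.mpr hj⟩]

end Hermitian

theorem dotProduct_diagonal_sub_vecMulVec_mulVec {ι : Type*} [Fintype ι] [DecidableEq ι]
    (x v : ι → ℝ) :
    v ⬝ᵥ (diagonal x - vecMulVec x x) *ᵥ v = ∑ i, x i * v i ^ 2 - (∑ i, x i * v i) ^ 2 := by
  rw [sub_mulVec, dotProduct_sub, vecMulVec_mulVec]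
  congr 1
  · simp only [dotProduct, mulVec_diagonal]
    exact Finset.sum_congr rfl fun i _ => by ring
  · simp only [dotProduct, Pi.smul_apply, MulOpposite.smul_eq_mul_unop, MulOpposite.unop_op]
    rw [sq, Finset.sum_mul]
    exact Finset.sum_congr rfl fun i _ => by ring

theorem sq_sum_mul_le_sum_mul_sum_mul_sq {ι : Type*} (s : Finset ι) {x : ι → ℝ}
    (hx : ∀ i ∈ s, 0 ≤ x i) (v : ι → ℝ) :
    (∑ i ∈ s, x i * v i) ^ 2 ≤ (∑ i ∈ s, x i) * ∑ i ∈ s, x i * v i ^ 2 :=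
  Finset.sum_sq_le_sum_mul_sum_of_sq_le_mul s hx
    (fun i hi => mul_nonneg (hx i hi) (sq_nonneg _)) fun i _ => (by ring : _ = _).le

theorem mul_mul_sq_add_nonneg {a b s q w : ℝ} (hb : 0 ≤ b) (hab : b ≤ a)
    (hs : s ^ 2 ≤ b * q) (hq : 0 ≤ q) :
    0 ≤ a * b * w ^ 2 + 2 * a * w * s + s ^ 2 + (a - b) * q := by
  rcases hb.eq_or_lt with rfl | hb
  · have hs0 : s = 0 := by nlinarith
    subst hs0
    nlinarith
  · refine nonneg_of_mul_nonneg_right (a := b) ?_ hb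
    nlinarith [mul_nonneg (sub_nonneg.mpr hab) (sub_nonneg.mpr hs),
      mul_nonneg (hb.le.trans hab) (sq_nonneg (b * w + s))]

/-- The quadratic form of `diag(x) - x xᵀ` on vectors supported on `insert k s`, where `x` is at
most `b` on `s`. -/
theorem sum_mul_sq_sub_sq_sum_le {ι : Type*} [DecidableEq ι] {s : Finset ι} {k : ι} (hk : k ∉ s)
    {x : ι → ℝ} {b : ℝ} (hx : ∀ i ∈ s, 0 ≤ x i) (hxb : ∀ i ∈ s, x i ≤ b) (hb : 0 ≤ b)
    (hbk : b ≤ x k) (hsum : ∑ i ∈ insert k s, x i ≤ 1) (v : ι → ℝ) :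
    ∑ i ∈ insert k s, x i * v i ^ 2 - (∑ i ∈ insert k s, x i * v i) ^ 2
      ≤ x k * (1 - x k + b) * ∑ i ∈ insert k s, v i ^ 2 := by
  simp only [Finset.sum_insert hk] at hsum ⊢
  have hS := Finset.sum_nonneg hx
  have hV : 0 ≤ ∑ i ∈ s, v i ^ 2 := Finset.sum_nonneg fun i _ => sq_nonneg (v i)
  have hW : ∑ i ∈ s, x i * v i ^ 2 ≤ b * ∑ i ∈ s, v i ^ 2 := by
    rw [Finset.mul_sum]
    exact Finset.sum_le_sum fun i hi => mul_le_mul_of_nonneg_right (hxb i hi) (sq_nonneg _)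
  have hcs : (∑ i ∈ s, x i * v i) ^ 2 ≤ b * ((1 - x k) * ∑ i ∈ s, v i ^ 2) := by
    calc (∑ i ∈ s, x i * v i) ^ 2 ≤ (∑ i ∈ s, x i) * ∑ i ∈ s, x i * v i ^ 2 :=
          sq_sum_mul_le_sum_mul_sum_mul_sq s hx v
      _ ≤ (∑ i ∈ s, x i) * (b * ∑ i ∈ s, v i ^ 2) := mul_le_mul_of_nonneg_left hW hS
      _ ≤ (1 - x k) * (b * ∑ i ∈ s, v i ^ 2) :=
          mul_le_mul_of_nonneg_right (by linarith) (mul_nonneg hb hV)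
      _ = b * ((1 - x k) * ∑ i ∈ s, v i ^ 2) := by ring
  have := mul_mul_sq_add_nonneg (w := v k) hb hbk hcs (mul_nonneg (by linarith) hV)
  linarith

/-- For `x ∈ ℝⁿ` sorted nonincreasingly, nonnegative, summing to 1, and
`A = diag(x) − x xᵀ`, the matrix `A` is symmetric positive semidefinite (so its singular
values coincide with its eigenvalues), and any nonincreasing enumeration `σ` of the
eigenvalues of `A` satisfies the interlacing chain
`x_k ≥ g_k(x) ≥ σ_k ≥ x_{k+1}` (1-indexed) with `σ_n = 0`, where
`g_k(x) = x_k (1 − x_k + x_{k+1})` and the convention `x_{n+1} = 0`. -/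
theorem stmt0 {n : ℕ} (x : Fin n → ℝ)
    (hmono : ∀ i j : Fin n, i ≤ j → x j ≤ x i)
    (hnonneg : ∀ i, 0 ≤ x i)
    (hsum : ∑ i, x i = 1)
    (A : Matrix (Fin n) (Fin n) ℝ)
    (hA : A = Matrix.diagonal x - Matrix.vecMulVec x x)
    (g : Fin n → ℝ)
    (hg : ∀ k : Fin n,
      g k = x k * (1 - x k + (if h : (k : ℕ) + 1 < n then x ⟨(k : ℕ) + 1, h⟩ else 0))) :
    A.PosSemidef ∧
      ∀ (hHerm : A.IsHermitian) (σ : Fin n → ℝ) (e : Equiv.Perm (Fin n)),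
        (∀ i, σ i = hHerm.eigenvalues (e i)) →
        (∀ i j : Fin n, i ≤ j → σ j ≤ σ i) →
        (∀ k : Fin n, g k ≤ x k) ∧
        (∀ k : Fin n, σ k ≤ g k) ∧
        (∀ (k : ℕ) (h : k + 1 < n), x ⟨k + 1, h⟩ ≤ σ ⟨k, by omega⟩) ∧
        (∀ h : 0 < n, σ ⟨n - 1, by omega⟩ = 0) := by
  subst hA
  have hpsd : (diagonal x - vecMulVec x x).PosSemidef := by
    refine PosSemidef.of_dotProduct_mulVec_nonneg ?_ fun v => ?_
    · refine IsHermitian.sub (isHermitian_diagonal x) ?_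
      ext i j
      simp [vecMulVec_apply, mul_comm]
    · rw [star_trivial, dotProduct_diagonal_sub_vecMulVec_mulVec, sub_nonneg]
      simpa [hsum] using sq_sum_mul_le_sum_mul_sum_mul_sq Finset.univ (fun i _ => hnonneg i) v
  refine ⟨hpsd, fun hHerm σ e hσ hanti => ⟨fun k => ?_, fun k => ?_, fun k h => ?_, fun h => ?_⟩⟩
  · rw [hg]
    refine mul_le_of_le_one_right (hnonneg k) ?_
    split_ifs with h
    · linarith [hmono k ⟨k + 1, h⟩ (Fin.le_def.mpr (Nat.le_succ _))]
    · linarith [hnonneg k]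
  · rw [hg]
    refine sorted_eigenvalue_le hHerm hσ hanti k
      (fun i : Finset.Iio k => LinearMap.proj (i : Fin n))
      (by rw [Fintype.card_coe, Fin.card_Iio]) fun v hv => ?_
    set b : ℝ := if h : (k : ℕ) + 1 < n then x ⟨(k : ℕ) + 1, h⟩ else 0 with hbdef
    have hb : 0 ≤ b := by rw [hbdef]; split_ifs <;> simp [hnonneg]
    have hbk : b ≤ x k := by
      rw [hbdef]
      split_ifs with h
      · exact hmono k ⟨k + 1, h⟩ (Fin.le_def.mpr (Nat.le_succ _))
      · exact hnonneg k
    have hxb : ∀ i ∈ Finset.Ioi k, x i ≤ b := fun i hi => by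
      have hki : (k : ℕ) < i := Fin.lt_def.mp (Finset.mem_Ioi.mp hi)
      rw [hbdef, dif_pos (by omega)]
      exact hmono _ _ (Fin.le_def.mpr hki)
    have hrestrict : ∀ f : Fin n → ℝ, (∀ i, v i = 0 → f i = 0) →
        ∑ i, f i = ∑ i ∈ insert k (Finset.Ioi k), f i := fun f hf => by
      refine (Finset.sum_subset (Finset.subset_univ _) fun i _ hi => hf i ?_).symm
      have hik : i < k := by
        rw [Finset.Ioi_insert, Finset.mem_Ici, not_le] at hi
        exact hi
      exact hv ⟨i, Finset.mem_Iio.mpr hik⟩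
    have hle : ∑ i ∈ insert k (Finset.Ioi k), x i ≤ 1 :=
      hsum ▸ Finset.sum_le_univ_sum_of_nonneg hnonneg
    have hvv : v ⬝ᵥ v = ∑ i, v i ^ 2 := by simp [dotProduct, sq]
    rw [dotProduct_diagonal_sub_vecMulVec_mulVec, hvv, hrestrict _ fun i hi => by simp [hi],
      hrestrict _ fun i hi => by simp [hi], hrestrict _ fun i hi => by simp [hi]]
    exact sum_mul_sq_sub_sq_sum_le (by simp) (fun i _ => hnonneg i) hxb hb hbk hle v
  · refine le_sorted_eigenvalue hHerm hσ hanti ⟨k, by omega⟩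
      (fun o : Option (Finset.Ioi (⟨k + 1, h⟩ : Fin n)) =>
        o.elim (dotProductBilin ℝ ℝ x) fun i => LinearMap.proj (i : Fin n))
      (by rw [Fintype.card_option, Fintype.card_coe, Fin.card_Ioi]; dsimp only; omega) fun v hv => ?_
    have hxv : ∑ i, x i * v i = 0 := hv none
    rw [dotProduct_diagonal_sub_vecMulVec_mulVec, hxv, dotProduct, Finset.mul_sum]
    simp only [ne_eq, OfNat.ofNat_ne_zero, not_false_eq_true, zero_pow, sub_zero, ← sq]
    refine Finset.sum_le_sum fun i _ => ?_
    rcases le_or_gt i ⟨k + 1, h⟩ with hi | hi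
    · exact mul_le_mul_of_nonneg_right (hmono _ _ hi) (sq_nonneg _)
    · have hvi : v i = 0 := hv (some ⟨i, Finset.mem_Ioi.mpr hi⟩)
      simp [hvi]
  · have hdet : (diagonal x - vecMulVec x x).det = 0 := by
      refine exists_mulVec_eq_zero_iff.mp ⟨1, fun h1 => one_ne_zero (congrFun h1 ⟨0, h⟩), ?_⟩
      ext i
      simp [sub_mulVec, vecMulVec_mulVec, mulVec_diagonal, dotProduct, hsum]
    rw [hHerm.det_eq_prod_eigenvalues, Finset.prod_eq_zero_iff] at hdet
    obtain ⟨i, -, hi⟩ := hdet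
    refine le_antisymm ?_ (hσ _ ▸ hpsd.eigenvalues_nonneg _)
    calc σ ⟨n - 1, by omega⟩ ≤ σ (e.symm i) := hanti _ _ (Fin.le_def.mpr (by simp; omega))
      _ = 0 := by simpa [hσ] using hi
end

section
/- For every z ∈ ℝⁿ with n ≥ 2, the spectral norm of the softmax Jacobian satisfies ‖diag(sm(z)) − sm(z) sm(z)ᵀ‖₂ ≤ g_1(sm(z)) ≤ 1/2, where g_1(s) = s_(1)(1 − s_(1) + s_(2)) and s_(k) denotes the k-th largest component of s. -/
open Matrix

/-- The softmax map `sm : ℝⁿ → ℝⁿ`, `sm(z)_i = exp z_i / Σ_j exp z_j`. -/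
noncomputable def softmax {n : ℕ} (z : Fin n → ℝ) : Fin n → ℝ :=
  fun i => Real.exp (z i) / ∑ j, Real.exp (z j)

/-- `kthLargest x k` is the `(k+1)`-th largest component of `x` (0-indexed `k`). -/
noncomputable def kthLargest {n : ℕ} (x : Fin n → ℝ) (k : Fin n) : ℝ :=
  x (Tuple.sort x k.rev)

/-- Spectral norm (largest singular value, i.e. ℓ²→ℓ² operator norm) of a real matrix. -/
noncomputable def specNorm {m n : Type*} [Fintype m] [Fintype n] [DecidableEq n]
    (A : Matrix m n ℝ) : ℝ :=
  ‖LinearMap.toContinuousLinearMap (Matrix.toEuclideanLin A)‖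

/-- A symmetric operator on a finite-dimensional space whose eigenvalues are bounded by `c`
in absolute value has operator norm at most `c`. -/
theorem LinearMap.IsSymmetric.opNorm_le_of_eigenvalue_bound {E : Type*} [NormedAddCommGroup E]
    [InnerProductSpace ℝ E] [FiniteDimensional ℝ E] {T : E →ₗ[ℝ] E} (hT : T.IsSymmetric) {c : ℝ}
    (hc : 0 ≤ c) (h : ∀ (μ : ℝ) (v : E), v ≠ 0 → T v = μ • v → |μ| ≤ c) :
    ‖LinearMap.toContinuousLinearMap T‖ ≤ c := by
  refine ContinuousLinearMap.opNorm_le_bound _ hc fun v => ?_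
  let b := hT.eigenvectorBasis rfl
  have hb : ∀ i, |hT.eigenvalues rfl i| ≤ c := fun i =>
    h _ (b i) (b.orthonormal.ne_zero i) (hT.apply_eigenvectorBasis rfl i)
  rw [LinearMap.coe_toContinuousLinearMap']
  refine le_of_sq_le_sq ?_ (by positivity)
  rw [mul_pow, ← b.repr.norm_map (T v), ← b.repr.norm_map v, EuclideanSpace.real_norm_sq_eq,
    EuclideanSpace.real_norm_sq_eq, Finset.mul_sum]
  refine Finset.sum_le_sum fun i _ => ?_
  have hi : b.repr (T v) i = hT.eigenvalues rfl i * b.repr v i := by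
    simpa using hT.eigenvectorBasis_apply_self_apply rfl v i
  rw [hi, mul_pow]
  exact mul_le_mul_of_nonneg_right (sq_le_sq.2 (by rw [abs_of_nonneg hc]; exact hb i))
    (sq_nonneg _)

/-- If `a ≥ b` are the two largest entries of a probability vector (`a` at position `p`), then
`t (1 - t + u) ≤ a (1 - a + b)` for any two entries `t ≥ u`. -/
theorem mul_one_sub_add_le_of_top_two {ι : Type*} {s : ι → ℝ} {p : ι} {b : ℝ}
    (hs : ∀ i, 0 ≤ s i) (hbp : b ≤ s p) (hp : s p ≤ 1) (hb : ∀ i, i ≠ p → s i ≤ b) {i j : ι}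
    (hij : i ≠ j) (hle : s j ≤ s i) :
    s i * (1 - s i + s j) ≤ s p * (1 - s p + b) := by
  by_cases hip : i = p
  · subst hip
    exact mul_le_mul_of_nonneg_left (by linarith [hb j hij.symm]) (hs i)
  · nlinarith [hb i hip, hs i, mul_nonneg (sub_nonneg.2 hbp) (sub_nonneg.2 hp),
      mul_nonneg (hs i) (sub_nonneg.2 hle)]

/-- Every eigenvalue of `diag(s) - s sᵀ`, for a probability vector `s` with two largest entries
`s p` and `b`, is at most `s p * (1 - s p + b)` in absolute value. -/
theorem abs_eigenvalue_le_of_top_two {ι : Type*} [Fintype ι] {s : ι → ℝ} {p : ι}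
    {b : ℝ} (hs : ∀ i, 0 ≤ s i) (hsum : ∑ i, s i = 1) (hb0 : 0 ≤ b) (hbp : b ≤ s p)
    (hb : ∀ i, i ≠ p → s i ≤ b) {μ : ℝ} {x : ι → ℝ} (hx : x ≠ 0)
    (h : ∀ i, s i * (x i - ∑ k, s k * x k) = μ * x i) :
    |μ| ≤ s p * (1 - s p + b) := by
  have hp : s p ≤ 1 := hsum ▸ Finset.single_le_sum (fun i _ => hs i) (Finset.mem_univ p)
  have : Nonempty ι := ⟨p⟩
  obtain ⟨i, hi⟩ := Finite.exists_max x
  obtain ⟨j, hj⟩ := Finite.exists_min x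
  set m := ∑ k, s k * x k with hm
  rcases (hi j).eq_or_lt with hxe | hlt
  · have hconst : ∀ k, x k = x i := fun k => le_antisymm (hi k) (hxe ▸ hj k)
    have hmi : m = x i := by
      simp only [hm, hconst, ← Finset.sum_mul, hsum, one_mul]
    have hxi : x i ≠ 0 := fun h0 => hx (funext fun k => (hconst k).trans h0)
    have hμ : μ = 0 := by
      have := h i
      rw [hmi, sub_self, mul_zero] at this
      exact (mul_eq_zero.1 this.symm).resolve_right hxi
    rw [hμ, abs_zero]
    exact mul_nonneg (hs p) (by linarith)
  · have hne : i ≠ j := fun e => by simp [e] at hlt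
    have hlow : s i * (x i - x j) ≤ m - x j := by
      have : m - x j = ∑ k, s k * (x k - x j) := by
        simp only [mul_sub, Finset.sum_sub_distrib, ← Finset.sum_mul, hsum, one_mul, hm]
      rw [this]
      exact Finset.single_le_sum (f := fun k => s k * (x k - x j))
        (fun k _ => mul_nonneg (hs k) (sub_nonneg.2 (hj k))) (Finset.mem_univ i)
    have hhigh : s j * (x i - x j) ≤ x i - m := by
      have : x i - m = ∑ k, s k * (x i - x k) := by
        simp only [mul_sub, Finset.sum_sub_distrib, ← Finset.sum_mul, hsum, one_mul, hm]
      rw [this]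
      exact Finset.single_le_sum (f := fun k => s k * (x i - x k))
        (fun k _ => mul_nonneg (hs k) (sub_nonneg.2 (hi k))) (Finset.mem_univ j)
    have hD : 0 < x i - x j := sub_pos.2 hlt
    have hμ : μ * (x i - x j) = s i * (x i - m) + s j * (m - x j) := by
      linear_combination h j - h i
    have hμ0 : 0 ≤ μ := by
      refine nonneg_of_mul_nonneg_left (b := x i - x j) ?_ hD
      rw [hμ]
      have h1 := (mul_nonneg (hs j) hD.le).trans hhigh
      have h2 := (mul_nonneg (hs i) hD.le).trans hlow
      exact add_nonneg (mul_nonneg (hs i) h1) (mul_nonneg (hs j) h2)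
    rw [abs_of_nonneg hμ0]
    rcases le_total (s j) (s i) with hle | hle
    · refine le_trans ?_ (mul_one_sub_add_le_of_top_two hs hbp hp hb hne hle)
      refine le_of_mul_le_mul_right ?_ hD
      rw [hμ]
      linear_combination mul_le_mul_of_nonneg_left hlow (sub_nonneg.2 hle)
    · refine le_trans ?_ (mul_one_sub_add_le_of_top_two hs hbp hp hb hne.symm hle)
      refine le_of_mul_le_mul_right ?_ hD
      rw [hμ]
      linear_combination mul_le_mul_of_nonneg_left hhigh (sub_nonneg.2 hle)

theorem softmax_pos {n : ℕ} (z : Fin n → ℝ) (i : Fin n) : 0 < softmax z i :=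
  div_pos (Real.exp_pos _) (Finset.sum_pos (fun _ _ => Real.exp_pos _) ⟨i, Finset.mem_univ i⟩)

theorem sum_softmax {n : ℕ} [NeZero n] (z : Fin n → ℝ) : ∑ i, softmax z i = 1 := by
  simp only [softmax, ← Finset.sum_div]
  exact div_self (Finset.sum_pos (fun _ _ => Real.exp_pos _) Finset.univ_nonempty).ne'

theorem le_kthLargest_one {n : ℕ} (h0 : 0 < n) (h1 : 1 < n) (x : Fin n → ℝ) (i : Fin n)
    (hi : i ≠ Tuple.sort x (Fin.rev ⟨0, h0⟩)) : x i ≤ kthLargest x ⟨1, h1⟩ := by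
  obtain ⟨k, rfl⟩ := (Tuple.sort x).surjective i
  refine Tuple.monotone_sort x (?_ : k ≤ _)
  have hk : k ≠ Fin.rev ⟨0, h0⟩ := fun e => hi (by rw [e])
  rw [Ne, Fin.ext_iff] at hk
  rw [Fin.le_def]
  simp only [Fin.val_rev] at hk ⊢
  omega

theorem specNorm_diagonal_sub_vecMulVec_le {ι : Type*} [Fintype ι] [DecidableEq ι] {s : ι → ℝ}
    {p : ι} {b : ℝ} (hs : ∀ i, 0 ≤ s i) (hsum : ∑ i, s i = 1) (hb0 : 0 ≤ b) (hbp : b ≤ s p)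
    (hb : ∀ i, i ≠ p → s i ≤ b) :
    specNorm (Matrix.diagonal s - Matrix.vecMulVec s s) ≤ s p * (1 - s p + b) := by
  have hp : s p ≤ 1 := hsum ▸ Finset.single_le_sum (fun i _ => hs i) (Finset.mem_univ p)
  have hherm : (Matrix.diagonal s - Matrix.vecMulVec s s).IsHermitian := by
    ext i j
    by_cases hij : i = j
    · simp [hij]
    · simp [Matrix.vecMulVec_apply, Matrix.diagonal_apply_ne _ hij,
        Matrix.diagonal_apply_ne _ (Ne.symm hij), mul_comm]
  refine LinearMap.IsSymmetric.opNorm_le_of_eigenvalue_bound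
    (Matrix.isSymmetric_toEuclideanLin_iff.2 hherm) (mul_nonneg (hs p) (by linarith))
    fun μ v hv h => ?_
  refine abs_eigenvalue_le_of_top_two (x := v.ofLp) hs hsum hb0 hbp hb
    (fun h0 => hv (by ext i; exact congrFun h0 i)) fun i => ?_
  have hi := congrArg (fun w => w.ofLp i) h
  simp only [Matrix.ofLp_toLpLin, Matrix.toLin'_apply, Matrix.sub_mulVec, Pi.sub_apply,
    Matrix.mulVec_diagonal, Matrix.vecMulVec_mulVec, PiLp.smul_apply, smul_eq_mul, dotProduct,
    Pi.smul_apply, MulOpposite.smul_eq_mul_unop, MulOpposite.unop_op] at hi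
  rw [← hi, mul_sub]


/-- for every `z ∈ ℝⁿ` with `n ≥ 2`,
`‖diag(sm z) − (sm z)(sm z)ᵀ‖₂ ≤ g₁(sm z) ≤ 1/2`,
where `g₁(s) = s₍₁₎(1 − s₍₁₎ + s₍₂₎)`. -/
theorem stmt1 {n : ℕ} (hn : 2 ≤ n) (z : Fin n → ℝ) :
    specNorm (Matrix.diagonal (softmax z) - Matrix.vecMulVec (softmax z) (softmax z)) ≤
        kthLargest (softmax z) ⟨0, by omega⟩ *
          (1 - kthLargest (softmax z) ⟨0, by omega⟩ + kthLargest (softmax z) ⟨1, by omega⟩) ∧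
      kthLargest (softmax z) ⟨0, by omega⟩ *
          (1 - kthLargest (softmax z) ⟨0, by omega⟩ + kthLargest (softmax z) ⟨1, by omega⟩) ≤
        1 / 2 := by
  have : NeZero n := ⟨by omega⟩
  have hs : ∀ i, 0 ≤ softmax z i := fun i => (softmax_pos z i).le
  have hsum := sum_softmax z
  have hbp : kthLargest (softmax z) ⟨1, by omega⟩ ≤ kthLargest (softmax z) ⟨0, by omega⟩ :=
    Tuple.monotone_sort (softmax z) (Fin.rev_le_rev.2 (by simp))
  refine ⟨specNorm_diagonal_sub_vecMulVec_le hs hsum (hs _) hbp (le_kthLargest_one _ _ _), ?_⟩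
  have hadd : kthLargest (softmax z) ⟨0, by omega⟩ + kthLargest (softmax z) ⟨1, by omega⟩ ≤ 1 := by
    rw [← hsum]
    exact Finset.add_le_sum (fun i _ => hs i) (Finset.mem_univ _) (Finset.mem_univ _)
      (fun e => by simpa [Fin.ext_iff] using Fin.rev_injective ((Tuple.sort _).injective e))
  have h0 : 0 ≤ kthLargest (softmax z) ⟨0, by omega⟩ := hs _
  nlinarith [mul_le_mul_of_nonneg_left hadd h0,
    sq_nonneg (2 * kthLargest (softmax z) ⟨0, by omega⟩ - 1)]
end

section
/- For n ≥ 2, the vector s = (1/2, 1/2, 0, …, 0) ∈ ℝⁿ satisfies g_1(s) = 1/2 and ‖diag(s) − s sᵀ‖₂ = 1/2, so the bound ‖diag(x) − x xᵀ‖₂ ≤ 1/2 for probability vectors x is attained. -/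
open Matrix

theorem kthLargest_eq_half {n : ℕ} (hn : 2 ≤ n) (s : Fin n → ℝ)
    (hs : ∀ i : Fin n, s i = if (i : ℕ) < 2 then (1 / 2 : ℝ) else 0)
    (k : Fin n) (hk : (k : ℕ) < 2) : kthLargest s k = 1 / 2 := by
  unfold kthLargest
  by_contra hne
  have h0 : s (Tuple.sort s k.rev) = 0 := by
    rw [hs] at hne ⊢
    split_ifs at hne ⊢ <;> simp_all
  have key : ∀ i : Fin n, (i : ℕ) < 2 → k.rev < (Tuple.sort s).symm i := by
    intro i hi
    by_contra! hle
    have hmono := Tuple.monotone_sort s hle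
    simp only [Function.comp_apply, Equiv.apply_symm_apply, h0] at hmono
    rw [hs, if_pos hi] at hmono
    norm_num at hmono
  have ha := key ⟨0, by omega⟩ (by simp)
  have hb := key ⟨1, by omega⟩ (by simp)
  have hab : (Tuple.sort s).symm ⟨0, by omega⟩ ≠ (Tuple.sort s).symm ⟨1, by omega⟩ := by
    simp
  rw [Fin.lt_def, Fin.val_rev] at ha hb
  rw [Ne, Fin.ext_iff] at hab
  omega

theorem diagonal_sub_vecMulVec_self_mulVec {n : ℕ} (s v : Fin n → ℝ) (i : Fin n) :
    ((Matrix.diagonal s - Matrix.vecMulVec s s) *ᵥ v) i = s i * (v i - s ⬝ᵥ v) := by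
  simp [Matrix.sub_mulVec, Matrix.mulVec_diagonal, Matrix.vecMulVec_mulVec]
  ring

theorem specNorm_diagonal_sub_vecMulVec_eq_half {n : ℕ} (hn : 2 ≤ n) (s : Fin n → ℝ)
    (hs : ∀ i : Fin n, s i = if (i : ℕ) < 2 then (1 / 2 : ℝ) else 0) :
    specNorm (Matrix.diagonal s - Matrix.vecMulVec s s) = 1 / 2 := by
  obtain ⟨m, rfl⟩ := Nat.exists_eq_add_of_le' hn
  have s0 : s 0 = 1 / 2 := by simp [hs]
  have s1 : s (Fin.succ 0) = 1 / 2 := by simp [hs]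
  have s2 : ∀ i : Fin m, s i.succ.succ = 0 := fun i => by simp [hs]
  have hdot : ∀ v : Fin (m + 2) → ℝ, s ⬝ᵥ v = (v 0 + v (Fin.succ 0)) / 2 := by
    intro v
    simp only [dotProduct, Fin.sum_univ_succ, s0, s1, s2, zero_mul, Finset.sum_const_zero]
    ring
  unfold specNorm
  apply le_antisymm
  · refine ContinuousLinearMap.opNorm_le_bound _ (by norm_num) fun v => ?_
    refine (sq_le_sq₀ (norm_nonneg _) (by positivity)).mp ?_
    rw [mul_pow, EuclideanSpace.real_norm_sq_eq, EuclideanSpace.real_norm_sq_eq]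
    simp only [LinearMap.coe_toContinuousLinearMap', Matrix.ofLp_toLpLin, Matrix.toLin'_apply,
      diagonal_sub_vecMulVec_self_mulVec, hdot]
    simp only [Fin.sum_univ_succ, s0, s1, s2, zero_mul, ne_eq, OfNat.ofNat_ne_zero,
      not_false_eq_true, zero_pow, Finset.sum_const_zero]
    have hnn : 0 ≤ ∑ i : Fin m, v i.succ.succ ^ 2 := Finset.sum_nonneg fun i _ => sq_nonneg _
    nlinarith [sq_nonneg (v 0 + v (Fin.succ 0))]
  · set v : EuclideanSpace ℝ (Fin (m + 2)) :=
      EuclideanSpace.single 0 1 - EuclideanSpace.single (Fin.succ 0) 1 with hv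
    have v0 : v 0 = 1 := by simp [hv]
    have v1 : v (Fin.succ 0) = -1 := by simp [hv]
    have hne : v ≠ 0 := fun h => by simp [h] at v0
    have hA : (LinearMap.toContinuousLinearMap
        (Matrix.toEuclideanLin (Matrix.diagonal s - Matrix.vecMulVec s s))) v
        = (1 / 2 : ℝ) • v := by
      ext i
      simp only [LinearMap.coe_toContinuousLinearMap', Matrix.ofLp_toLpLin, Matrix.toLin'_apply,
        diagonal_sub_vecMulVec_self_mulVec, hdot, v0, v1, PiLp.smul_apply, smul_eq_mul]
      refine Fin.cases ?_ (fun j => Fin.cases ?_ (fun l => ?_) j) i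
      · simp [s0]
      · rw [s1]; ring
      · simp [s2, hv, Fin.ext_iff]
    have hle := ContinuousLinearMap.le_opNorm (LinearMap.toContinuousLinearMap
        (Matrix.toEuclideanLin (Matrix.diagonal s - Matrix.vecMulVec s s))) v
    rw [hA, norm_smul, Real.norm_of_nonneg (by norm_num)] at hle
    exact le_of_mul_le_mul_right hle (norm_pos_iff.mpr hne)

/-- for `n ≥ 2`, the vector `s = (1/2, 1/2, 0, …, 0) ∈ ℝⁿ` satisfies
`g₁(s) = 1/2` and `‖diag(s) − s sᵀ‖₂ = 1/2`, so the bound `≤ 1/2` for probability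
vectors is attained. -/
theorem stmt2 {n : ℕ} (hn : 2 ≤ n) (s : Fin n → ℝ)
    (hs : ∀ i : Fin n, s i = if (i : ℕ) < 2 then (1 / 2 : ℝ) else 0) :
    kthLargest s ⟨0, by omega⟩ *
        (1 - kthLargest s ⟨0, by omega⟩ + kthLargest s ⟨1, by omega⟩) = 1 / 2 ∧
      specNorm (Matrix.diagonal s - Matrix.vecMulVec s s) = 1 / 2 := by
  refine ⟨?_, specNorm_diagonal_sub_vecMulVec_eq_half hn s hs⟩
  rw [kthLargest_eq_half hn s hs _ (by simp), kthLargest_eq_half hn s hs _ (by simp)]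
  norm_num
end

section
/- Let x ∈ ℝⁿ be a probability vector and let k be an integer with 2 ≤ k ≤ n−1. If g_1(x) = g_k(x), then either x_(1) = 1 or x_(1) = x_(2) = … = x_(k). -/
theorem kthLargest_antitone {n : ℕ} (x : Fin n → ℝ) : Antitone (kthLargest x) :=
  fun _ _ h => Tuple.monotone_sort x (Fin.rev_le_rev.mpr h)

/-- The inequality `(a - c) (1 - a) ≤ a (1 - a + b) - c (1 - c + d)` forces equality here. -/
theorem eq_one_or_eq_of_mul_eq {a b c d : ℝ} (ha : a ≤ 1) (hac : c ≤ a) (hbc : c ≤ b)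
    (hcd : d ≤ c) (hc : 0 ≤ c) (h : a * (1 - a + b) = c * (1 - c + d)) : a = 1 ∨ c = a := by
  have h0 : (a - c) * (1 - a) = 0 := by
    refine le_antisymm ?_ (mul_nonneg (sub_nonneg.mpr hac) (sub_nonneg.mpr ha))
    nlinarith [mul_nonneg (hc.trans hac) (sub_nonneg.mpr hbc), mul_nonneg hc (sub_nonneg.mpr hcd)]
  rcases mul_eq_zero.mp h0 with h1 | h1
  · right; linarith
  · left; linarith

/-- let `x ∈ ℝⁿ` be a probability vector and `2 ≤ k ≤ n − 1`.
If `g₁(x) = g_k(x)` (with `g_j(x) = x₍ⱼ₎(1 − x₍ⱼ₎ + x₍ⱼ₊₁₎)`, 1-indexed order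
statistics), then either `x₍₁₎ = 1` or `x₍₁₎ = x₍₂₎ = … = x₍ₖ₎`. -/
theorem stmt5 {n : ℕ} (x : Fin n → ℝ) (hx : ∀ i, 0 ≤ x i) (hsum : ∑ i, x i = 1)
    (k : ℕ) (hk1 : 2 ≤ k) (hk2 : k + 1 ≤ n)
    (hg : kthLargest x ⟨0, by omega⟩ *
            (1 - kthLargest x ⟨0, by omega⟩ + kthLargest x ⟨1, by omega⟩) =
          kthLargest x ⟨k - 1, by omega⟩ *
            (1 - kthLargest x ⟨k - 1, by omega⟩ + kthLargest x ⟨k, by omega⟩)) :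
    kthLargest x ⟨0, by omega⟩ = 1 ∨
      ∀ (j : ℕ) (hj : j < k), kthLargest x ⟨j, by omega⟩ = kthLargest x ⟨0, by omega⟩ := by
  have hle : kthLargest x ⟨0, by omega⟩ ≤ 1 :=
    hsum ▸ Finset.single_le_sum (fun i _ => hx i) (Finset.mem_univ _)
  have anti (i j : ℕ) (hij : i ≤ j) (hj : j < n) :
      kthLargest x ⟨j, hj⟩ ≤ kthLargest x ⟨i, by omega⟩ :=
    kthLargest_antitone x (Fin.mk_le_mk.mpr hij)
  refine (eq_one_or_eq_of_mul_eq hle (anti 0 (k - 1) (by omega) (by omega))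
    (anti 1 (k - 1) (by omega) (by omega)) (anti (k - 1) k (by omega) (by omega))
    (hx _) hg).imp id fun h j hj => ?_
  exact le_antisymm (anti 0 j (by omega) (by omega))
    (h ▸ anti j (k - 1) (by omega) (by omega))
end

section
/- Let X ∈ ℝ^{N×D} with every row satisfying ‖X_{j,:}‖₂ ≤ R, and let p ∈ ℝᴺ be a probability vector. Then ‖Xᵀ (diag(p) − p pᵀ)‖₂ ≤ R. -/
open Matrix

/-- The mean absolute deviation of `v` under the probability vector `p` is at most the
Euclidean norm of `v`. -/
theorem sum_mul_abs_sub_mean_le_norm {ι : Type*} [Fintype ι] (p : ι → ℝ) (hp : ∀ j, 0 ≤ p j)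
    (hsum : ∑ j, p j = 1) (v : EuclideanSpace ℝ ι) :
    ∑ j, p j * |v j - ∑ i, p i * v i| ≤ ‖v‖ := by
  set m := ∑ i, p i * v i with hm
  refine (abs_le_of_sq_le_sq' ?_ (norm_nonneg v)).2
  have cauchy : (∑ j, p j * |v j - m|) ^ 2 ≤ (∑ j, p j) * ∑ j, p j * (v j - m) ^ 2 := by
    refine Finset.sum_sq_le_sum_mul_sum_of_sq_le_mul _ (fun j _ => hp j)
      (fun j _ => mul_nonneg (hp j) (sq_nonneg _)) fun j _ => ?_
    rw [mul_pow, sq_abs]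
    apply le_of_eq
    ring
  have variance : ∑ j, p j * (v j - m) ^ 2 = ∑ j, p j * v j ^ 2 - m ^ 2 := by
    have expand : ∀ j, p j * (v j - m) ^ 2 =
        p j * v j ^ 2 - 2 * m * (p j * v j) + m ^ 2 * p j := fun j => by ring
    simp_rw [expand, Finset.sum_add_distrib, Finset.sum_sub_distrib, ← Finset.mul_sum, hsum,
      ← hm]
    ring
  have weights : ∑ j, p j * v j ^ 2 ≤ ∑ j, v j ^ 2 := by
    refine Finset.sum_le_sum fun j _ => mul_le_of_le_one_left (sq_nonneg _) ?_
    rw [← hsum]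
    exact Finset.single_le_sum (fun i _ => hp i) (Finset.mem_univ j)
  rw [EuclideanSpace.real_norm_sq_eq]
  rw [hsum, one_mul, variance] at cauchy
  nlinarith [sq_nonneg m]

/-- The matrix `Xᵀ (diag p - p pᵀ)` sends `v` to the `p`-weighted sum of the rows of `X` with
coefficients the deviations of `v` from its mean. -/
theorem toEuclideanLin_transpose_mul_diagonal_sub_vecMulVec {m n : Type*} [Fintype m] [Fintype n]
    [DecidableEq m] (X : Matrix m n ℝ) (p : m → ℝ) (v : EuclideanSpace ℝ m) :
    Matrix.toEuclideanLin (Xᵀ * (Matrix.diagonal p - Matrix.vecMulVec p p)) v =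
      ∑ j, (p j * (v j - ∑ i, p i * v i)) • WithLp.toLp 2 (X j) := by
  ext b
  rw [Matrix.toLpLin_apply, ← Matrix.mulVec_mulVec, Matrix.sub_mulVec, Matrix.vecMulVec_mulVec]
  simp only [Matrix.mulVec, dotProduct, WithLp.ofLp_sum, Finset.sum_apply, WithLp.ofLp_smul,
    Pi.smul_apply, smul_eq_mul, Pi.sub_apply, Matrix.transpose_apply,
    MulOpposite.smul_eq_mul_unop, MulOpposite.unop_op, Matrix.diagonal_apply, ite_mul, zero_mul,
    Finset.sum_ite_eq, Finset.mem_univ, if_true]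
  exact Finset.sum_congr rfl fun j _ => by ring

/-- if every row of `X ∈ ℝ^{N×D}` has Euclidean norm at most `R` and
`p ∈ ℝᴺ` is a probability vector, then `‖Xᵀ (diag(p) − p pᵀ)‖₂ ≤ R`. -/
theorem stmt10 {N D : ℕ} (R : ℝ)
    (X : Matrix (Fin N) (Fin D) ℝ)
    (hX : ∀ j : Fin N, Real.sqrt (∑ b, X j b ^ 2) ≤ R)
    (p : Fin N → ℝ) (hp : ∀ j, 0 ≤ p j) (hsum : ∑ j, p j = 1) :
    specNorm (Xᵀ * (Matrix.diagonal p - Matrix.vecMulVec p p)) ≤ R := by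
  obtain ⟨j₀⟩ : Nonempty (Fin N) := by
    by_contra h
    rw [not_nonempty_iff] at h
    simp at hsum
  have hR : 0 ≤ R := (Real.sqrt_nonneg _).trans (hX j₀)
  refine ContinuousLinearMap.opNorm_le_bound _ hR fun v => ?_
  rw [LinearMap.coe_toContinuousLinearMap',
    toEuclideanLin_transpose_mul_diagonal_sub_vecMulVec]
  calc ‖∑ j, (p j * (v j - ∑ i, p i * v i)) • WithLp.toLp 2 (X j)‖
      ≤ ∑ j, R * (p j * |v j - ∑ i, p i * v i|) := by
        refine norm_sum_le_of_le _ fun j _ => ?_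
        have row : ‖WithLp.toLp 2 (X j)‖ ≤ R := by
          simpa [EuclideanSpace.norm_eq] using hX j
        rw [norm_smul, Real.norm_eq_abs, abs_mul, abs_of_nonneg (hp j), mul_comm]
        exact mul_le_mul_of_nonneg_right row (mul_nonneg (hp j) (abs_nonneg _))
    _ = R * ∑ j, p j * |v j - ∑ i, p i * v i| := (Finset.mul_sum _ _ _).symm
    _ ≤ R * ‖v‖ := mul_le_mul_of_nonneg_left (sum_mul_abs_sub_mean_le_norm p hp hsum v) hR
end
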